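/- For x ≥ 0 and n ∈ ℕ⁺, define K_n(x) := { (y_1, ..., y_n) ∈ ℝ_+^n : y_1 + ... + y_i ≤ i x for all i = 1, ..., n }. Then the n-dimensional Lebesgue measure of K_n(x) equals (n+1)^{n−1} x^n / n!. -/

import Mathlib

open MeasureTheory

/-- Generalised constrained simplex. -/
def KK (n : ℕ) (x a : ℝ) : Set (Fin n → ℝ) :=
  {y | (∀ j, 0 ≤ y j) ∧ ∀ i : Fin n, ∑ j ∈ Finset.Iic i, y j ≤ a + (i : ℕ) * x}

lemma KK_meas (n : ℕ) (x a : ℝ) : MeasurableSet (KK n x a) := by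
  unfold KK
  apply IsClosed.measurableSet
  simp only [Set.setOf_and, Set.setOf_forall]
  refine IsClosed.inter (isClosed_iInter fun j => isClosed_le (by fun_prop) (by fun_prop))
    (isClosed_iInter fun j => isClosed_le (by fun_prop) (by fun_prop))

lemma sum_Iic_succ' {n : ℕ} (y : Fin (n + 1) → ℝ) (i : Fin n) :
    ∑ j ∈ Finset.Iic i.succ, y j = y 0 + ∑ j ∈ Finset.Iic i, y j.succ := by
  have h1 : Finset.Iic i.succ = Finset.univ.filter (fun j => j ≤ i.succ) := by ext; simp
  have h2 : Finset.Iic i = Finset.univ.filter (fun j => j ≤ i) := by ext; simp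
  rw [h1, h2, Finset.sum_filter, Finset.sum_filter, Fin.sum_univ_succ]
  simp

lemma KK_cons (n : ℕ) (x a : ℝ) (y : Fin (n + 1) → ℝ) :
    y ∈ KK (n + 1) x a ↔ y 0 ∈ Set.Icc 0 a ∧ (fun j => y (Fin.succ j)) ∈ KK n x (a - y 0 + x) := by
  have h0 : Finset.Iic (0 : Fin (n + 1)) = {0} := by
    ext j; simp
  simp only [KK, Set.mem_setOf_eq, Fin.forall_fin_succ, sum_Iic_succ', h0, Set.mem_Icc,
    Finset.sum_singleton, Fin.val_zero, Fin.val_succ]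
  push_cast
  have : ∀ i : Fin n, (y 0 + ∑ j ∈ Finset.Iic i, y j.succ ≤ a + ((i : ℕ) + 1 : ℝ) * x) ↔
      (∑ j ∈ Finset.Iic i, y j.succ ≤ a - y 0 + x + ((i : ℕ) : ℝ) * x) := by
    intro i
    constructor <;> intro h <;> linarith
  simp only [this, zero_mul, add_zero]
  tauto

lemma KK_rec (n : ℕ) (x a : ℝ) :
    volume (KK (n + 1) x a) = ∫⁻ t in Set.Icc 0 a, volume (KK n x (a - t + x)) := by
  have hp := (volume_preserving_piFinSuccAbove (fun _ : Fin (n + 1) => ℝ) 0).symm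
  rw [← hp.measure_preimage (KK_meas _ _ _).nullMeasurableSet]
  have hm := hp.measurable (KK_meas (n + 1) x a)
  rw [Measure.volume_eq_prod, Measure.prod_apply hm, ← lintegral_indicator measurableSet_Icc]
  congr 1
  ext t
  have key : ∀ z : Fin n → ℝ,
      (MeasurableEquiv.piFinSuccAbove (fun _ : Fin (n + 1) => ℝ) 0).symm (t, z) ∈ KK (n + 1) x a ↔
      t ∈ Set.Icc 0 a ∧ z ∈ KK n x (a - t + x) := by
    intro z
    rw [KK_cons]
    simp [MeasurableEquiv.piFinSuccAbove]
  by_cases ht : t ∈ Set.Icc 0 a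
  · rw [Set.indicator_of_mem ht]
    congr 1
    ext z
    exact (key z).trans (by simp only [ht, true_and])
  · rw [Set.indicator_of_notMem ht]
    convert measure_empty (μ := (volume : Measure (Fin n → ℝ)))
    ext z
    exact (key z).trans (by simp only [ht, false_and, Set.mem_empty_iff_false])

lemma KK_vol (n : ℕ) (x : ℝ) (hx : 0 ≤ x) : ∀ a : ℝ, 0 ≤ a →
    volume (KK (n + 1) x a) =
      ENNReal.ofReal (a * (a + (n + 1) * x) ^ n / (n + 1).factorial) := by
  induction n with
  | zero =>
    intro a ha
    rw [KK_rec]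
    have : ∀ b, KK 0 x b = Set.univ := by
      intro b; ext y; simp [KK]
    have hv : volume (Set.univ : Set (Fin 0 → ℝ)) = 1 := by
      rw [volume_pi, Measure.pi_of_empty]; simp
    simp [this, hv]
  | succ n ih =>
    intro a ha
    rw [KK_rec]
    have h1 : ∫⁻ t in Set.Icc 0 a, volume (KK (n + 1) x (a - t + x)) =
        ∫⁻ t in Set.Icc 0 a, ENNReal.ofReal
          ((a - t + x) * ((a - t + x) + (n + 1) * x) ^ n / (n + 1).factorial) := by
      refine setLIntegral_congr_fun measurableSet_Icc fun t ht => ?_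
      exact ih _ (by linarith [ht.2])
    rw [h1, ← ofReal_integral_eq_lintegral_ofReal]
    · congr 1
      rw [integral_Icc_eq_integral_Ioc, ← intervalIntegral.integral_of_le ha]
      have hd : ∀ t ∈ Set.uIcc 0 a, HasDerivAt
          (fun t : ℝ => -((a - t) * ((a - t) + (n + 2) * x) ^ (n + 1) / (n + 2).factorial))
          ((a - t + x) * ((a - t + x) + (n + 1) * x) ^ n / (n + 1).factorial) t := by
        intro t _
        have e1 : HasDerivAt (fun t : ℝ => a - t) (-1) t := by
          simpa using (hasDerivAt_id t).const_sub a
        have e2 := (e1.mul ((e1.add_const ((n + 2) * x)).pow (n + 1))).div_const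
          ((n + 2).factorial : ℝ) |>.neg
        refine e2.congr_deriv ?_
        have hf : ((n + 2).factorial : ℝ) = (n + 2) * (n + 1).factorial := by
          rw [Nat.factorial_succ (n + 1)]; push_cast; ring
        have hf0 : ((n + 1).factorial : ℝ) ≠ 0 := by positivity
        have hn0 : (n + 2 : ℝ) ≠ 0 := by positivity
        rw [hf]
        have e3 : a - t + x + (n + 1) * x = a - t + (n + 2) * x := by ring
        rw [e3]
        simp only [Nat.add_sub_cancel, Pi.pow_apply]
        field_simp
        push_cast
        ring
      rw [intervalIntegral.integral_eq_sub_of_hasDerivAt hd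
        (Continuous.intervalIntegrable (by fun_prop) _ _)]
      push_cast
      simp
      ring_nf
    · exact (Continuous.integrableOn_Icc (by fun_prop))
    · refine (ae_restrict_iff' measurableSet_Icc).2 (Filter.Eventually.of_forall fun t ht => ?_)
      have : 0 ≤ a - t := by linarith [ht.2]
      simp only [Pi.zero_apply]
      positivity

/-- For `x ≥ 0` and `n ≥ 1`, the set
`K_n(x) = {y ∈ ℝ₊ⁿ : y_1 + ⋯ + y_i ≤ i x for all i = 1, …, n}` has
`n`-dimensional Lebesgue measure `(n+1)^{n-1} xⁿ / n!`. -/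
theorem volume_constrained_simplex_zero (n : ℕ) (hn : 1 ≤ n) (x : ℝ) (hx : 0 ≤ x) :
    volume {y : Fin n → ℝ | (∀ j, 0 ≤ y j) ∧
        ∀ i : Fin n, ∑ j ∈ Finset.Iic i, y j ≤ ((i : ℕ) + 1) * x}
      = ENNReal.ofReal (((n : ℝ) + 1) ^ (n - 1) * x ^ n / Nat.factorial n) := by
  obtain ⟨m, rfl⟩ : ∃ m, n = m + 1 := ⟨n - 1, by omega⟩
  have h := KK_vol m x hx x hx
  have e : x * (x + (m + 1) * x) ^ m = (((m + 1 : ℕ) : ℝ) + 1) ^ (m + 1 - 1) * x ^ (m + 1) := by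
    have : x + (m + 1) * x = (((m + 1 : ℕ) : ℝ) + 1) * x := by push_cast; ring
    rw [this, mul_pow, Nat.add_sub_cancel]
    ring
  rw [e] at h
  rw [← h]
  congr 1
  ext y
  simp only [KK, Set.mem_setOf_eq, add_mul, one_mul, add_comm x]
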